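/- arXiv:1812.02017 — 11 statements merged into one kernel-verified Lean document; each statement's English description precedes it below -/
import Mathlib

section
/- Consider differentiable functions u1, u2, u3 : [0,∞) → ℝ satisfying for all t ≥ 0 the system u1' = (2a1/(1+k·u3) − 1)·u1, u2' = (2a2/(1+k·u3) − 1)·p2·u2 + 2(1 − a1/(1+k·u3))·u1, u3' = 2(1 − a2/(1+k·u3))·p2·u2 − d3·u3, and such that 1 + k·u3(t) > 0 for all t ≥ 0. If u1(0) > 0, u2(0) ≥ 0 and u3(0) ≥ 0, then u1(t) > 0, u2(t) ≥ 0 and u3(t) ≥ 0 for all t ≥ 0 (the nonnegative octant is forward invariant). -/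
theorem aux_compare (c y g : ℝ → ℝ) (hc : Continuous c)
    (hy : ∀ t ≥ (0 : ℝ), HasDerivWithinAt y (c t * y t + g t) (Set.Ici 0) t)
    (a b : ℝ) (ha : 0 ≤ a) (hab : a ≤ b) (hg : ∀ t ∈ Set.Icc a b, 0 ≤ g t) :
    (0 ≤ y a → 0 ≤ y b) ∧ (0 < y a → 0 < y b) := by
  set C : ℝ → ℝ := fun t => ∫ s in (0 : ℝ)..t, c s with hC
  have hCd : ∀ t, HasDerivAt C (c t) t := fun t => hc.integral_hasStrictDerivAt 0 t |>.hasDerivAt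
  have hE : ∀ t, HasDerivAt (fun t => Real.exp (-C t)) (Real.exp (-C t) * (-c t)) t :=
    fun t => (hCd t).neg.exp
  have hz : ∀ t ∈ Set.Icc a b, HasDerivWithinAt (fun t => y t * Real.exp (-C t))
      (g t * Real.exp (-C t)) (Set.Icc a b) t := by
    intro t ht
    have h := ((hy t (ha.trans ht.1)).mono
      (fun s hs => ha.trans hs.1 : Set.Icc a b ⊆ Set.Ici 0)).mul (hE t).hasDerivWithinAt
    refine h.congr_deriv ?_
    ring
  have hm : MonotoneOn (fun t => y t * Real.exp (-C t)) (Set.Icc a b) := by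
    refine monotoneOn_of_hasDerivWithinAt_nonneg (f' := fun t => g t * Real.exp (-C t))
      (convex_Icc a b) (fun t ht => (hz t ht).continuousWithinAt) ?_ ?_
    · intro t ht
      exact (hz t (interior_subset ht)).mono interior_subset
    · intro t ht
      exact mul_nonneg (hg t (interior_subset ht)) (Real.exp_pos _).le
  have h := hm (Set.left_mem_Icc.2 hab) (Set.right_mem_Icc.2 hab) hab
  simp only at h
  constructor
  · intro h0
    exact nonneg_of_mul_nonneg_left ((mul_nonneg h0 (Real.exp_pos _).le).trans h) (Real.exp_pos _)
  · intro h0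
    exact pos_of_mul_pos_left ((mul_pos h0 (Real.exp_pos _)).trans_le h) (Real.exp_pos _).le

theorem aux_ext (u : ℝ → ℝ) (hu : ContinuousOn u (Set.Ici 0)) :
    Continuous (fun t => u (max t 0)) :=
  hu.comp_continuous (by fun_prop) (fun t => le_max_right t 0)

/-- **Forward invariance of the nonnegative octant** for the dimensionless
three-compartment hematopoiesis model
u1' = (2a1/(1+k·u3) − 1)·u1,
u2' = (2a2/(1+k·u3) − 1)·p2·u2 + 2(1 − a1/(1+k·u3))·u1,
u3' = 2(1 − a2/(1+k·u3))·p2·u2 − d3·u3. -/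
theorem stmt_0 (a1 a2 p2 d3 k : ℝ)
    (ha1 : a1 ∈ Set.Ioo (0 : ℝ) 1) (ha2 : a2 ∈ Set.Ioo (0 : ℝ) 1)
    (hp2 : 0 < p2) (hd3 : 0 < d3) (hk : 0 < k)
    (u1 u2 u3 : ℝ → ℝ)
    (hden : ∀ t ≥ (0 : ℝ), 0 < 1 + k * u3 t)
    (h1 : ∀ t ≥ (0 : ℝ), HasDerivWithinAt u1
      ((2 * a1 / (1 + k * u3 t) - 1) * u1 t) (Set.Ici 0) t)
    (h2 : ∀ t ≥ (0 : ℝ), HasDerivWithinAt u2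
      ((2 * a2 / (1 + k * u3 t) - 1) * p2 * u2 t
        + 2 * (1 - a1 / (1 + k * u3 t)) * u1 t) (Set.Ici 0) t)
    (h3 : ∀ t ≥ (0 : ℝ), HasDerivWithinAt u3
      (2 * (1 - a2 / (1 + k * u3 t)) * p2 * u2 t - d3 * u3 t) (Set.Ici 0) t)
    (h10 : 0 < u1 0) (h20 : 0 ≤ u2 0) (h30 : 0 ≤ u3 0) :
    ∀ t ≥ (0 : ℝ), 0 < u1 t ∧ 0 ≤ u2 t ∧ 0 ≤ u3 t := by
  have hc2 := aux_ext u2 (fun t ht => (h2 t ht).continuousWithinAt)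
  have hc3 := aux_ext u3 (fun t ht => (h3 t ht).continuousWithinAt)
  have hne : ∀ t : ℝ, 1 + k * u3 (max t 0) ≠ 0 := fun t => (hden _ (le_max_right t 0)).ne'
  have hcoef : ∀ a p : ℝ, Continuous (fun t => (2 * a / (1 + k * u3 (max t 0)) - 1) * p) := by
    intro a p
    exact ((continuous_const.div (continuous_const.add (continuous_const.mul hc3)) hne).sub continuous_const).mul continuous_const
  have hpos1 : ∀ t ≥ (0 : ℝ), 0 < u1 t := by
    intro t ht
    refine (aux_compare _ u1 (fun _ => 0) (hcoef a1 1) ?_ 0 t le_rfl ht (by simp)).2 h10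
    intro s hs
    refine (h1 s hs).congr_deriv ?_
    simp only [max_eq_left hs.le]
    ring
  have hstep : ∀ a b : ℝ, 0 ≤ a → a ≤ b →
      (∀ t ∈ Set.Icc a b, a1 < 1 + k * u3 t ∧ a2 < 1 + k * u3 t) →
      0 ≤ u2 a → 0 ≤ u3 a → 0 ≤ u2 b ∧ 0 ≤ u3 b := by
    intro a b ha hab hs h2a h3a
    have hu2 : ∀ b' ∈ Set.Icc a b, 0 ≤ u2 b' := by
      intro b' hb'
      refine (aux_compare _ u2 (fun t => 2 * (1 - a1 / (1 + k * u3 t)) * u1 t) (hcoef a2 p2)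
        ?_ a b' ha hb'.1 ?_).1 h2a
      · intro s hs
        refine (h2 s hs).congr_deriv ?_
        simp only [max_eq_left hs.le]
      · intro t ht
        have ht0 : 0 ≤ t := ha.trans ht.1
        have := (div_lt_one (hden t ht0)).2 (hs t ⟨ht.1, ht.2.trans hb'.2⟩).1
        have := hpos1 t ht0
        exact mul_nonneg (by linarith) this.le
    refine ⟨hu2 b ⟨hab, le_rfl⟩, ?_⟩
    refine (aux_compare (fun _ => -d3) u3 (fun t => 2 * (1 - a2 / (1 + k * u3 t)) * p2 * u2 t)
      continuous_const ?_ a b ha hab ?_).1 h3a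
    · intro s hs
      refine (h3 s hs).congr_deriv ?_
      ring
    · intro t ht
      have := (div_lt_one (hden t (ha.trans ht.1))).2 (hs t ht).2
      exact mul_nonneg (mul_nonneg (by linarith) hp2.le) (hu2 t ht)
  intro T hT
  refine ⟨hpos1 T hT, ?_⟩
  set S : Set ℝ := {t | 0 ≤ u2 (max t 0) ∧ 0 ≤ u3 (max t 0)} with hS
  have hScl : IsClosed S :=
    (isClosed_le continuous_const hc2).inter (isClosed_le continuous_const hc3)
  have hsub : Set.Icc 0 T ⊆ S := by
    refine IsClosed.Icc_subset_of_forall_mem_nhdsWithin (hScl.inter isClosed_Icc) ?_ ?_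
    · simpa [hS] using ⟨h20, h30⟩
    · rintro x ⟨hxS, hx0, hxT⟩
      simp only [hS, Set.mem_ofPred_eq, max_eq_left hx0] at hxS
      have hcont : Continuous (fun t => 1 + k * u3 (max t 0)) :=
        continuous_const.add (continuous_const.mul hc3)
      have hge : 1 ≤ 1 + k * u3 (max x 0) := by
        rw [max_eq_left hx0]
        have := mul_nonneg hk.le hxS.2
        linarith
      have hev : ∀ᶠ t in nhds x, a1 < 1 + k * u3 (max t 0) ∧ a2 < 1 + k * u3 (max t 0) :=
        (hcont.continuousAt.eventually (lt_mem_nhds (ha1.2.trans_le hge))).and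
          (hcont.continuousAt.eventually (lt_mem_nhds (ha2.2.trans_le hge)))
      obtain ⟨e, he, hball⟩ := Metric.eventually_nhds_iff.1 hev
      filter_upwards [Ioo_mem_nhdsGT (show x < x + e by linarith)] with y hy
      have hy0 : 0 ≤ y := hx0.trans hy.1.le
      simp only [hS, Set.mem_ofPred_eq, max_eq_left hy0]
      refine hstep x y hx0 hy.1.le ?_ hxS.1 hxS.2
      intro t ht
      have := hball (y := t) (by
        rw [Real.dist_eq, abs_of_nonneg (by linarith [ht.1])]
        linarith [ht.2, hy.2])
      rwa [max_eq_left (hx0.trans ht.1)] at this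
  have := hsub (Set.right_mem_Icc.2 hT)
  simpa only [hS, Set.mem_ofPred_eq, max_eq_left hT] using this
end

section
/- Let a1, a2 ∈ (0,1), p2 > 0, d3 > 0, k > 0, and let u1, u2, u3 : [0,∞) → ℝ be a differentiable solution of the dimensionless three-compartment hematopoiesis model with u1(t) > 0, u2(t) > 0, u3(t) > 0 for all t ≥ 0. Then each component ui is bounded on [0,∞), i.e., there exist constants C1, C2, C3 (depending only on the parameters and the initial values) such that ui(t) ≤ Ci for all t ≥ 0 and i = 1, 2, 3. -/
/-- A differentiable function that starts below `C` and strictly decreases whenever it equals `C`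
stays below `C`. -/
lemma barrier (f f' : ℝ → ℝ) (C : ℝ)
    (hf : ∀ t ≥ (0 : ℝ), HasDerivWithinAt f (f' t) (Set.Ici 0) t)
    (h0 : f 0 ≤ C) (hC : ∀ t ≥ (0 : ℝ), f t = C → f' t < 0) :
    ∀ t ≥ (0 : ℝ), f t ≤ C := by
  intro t ht
  refine image_le_of_deriv_right_lt_deriv_boundary (f := f) (f' := f') (a := 0) (b := t)
    (B := fun _ => C) (B' := fun _ => 0) ?_ ?_ h0 (fun x => hasDerivAt_const x C) ?_ ⟨ht, le_rfl⟩
  · intro x hx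
    exact ((hf x hx.1).continuousWithinAt).mono (fun y hy => hy.1)
  · intro x hx
    exact (hf x hx.1).mono (Set.Ici_subset_Ici.2 hx.1)
  · intro x hx h
    exact hC x hx.1 h

/-- **Uniform boundedness of positive solutions** of the dimensionless
three-compartment hematopoiesis model: every componentwise positive solution
is bounded on [0,∞). -/
theorem stmt_1 (a1 a2 p2 d3 k : ℝ)
    (ha1 : a1 ∈ Set.Ioo (0 : ℝ) 1) (ha2 : a2 ∈ Set.Ioo (0 : ℝ) 1)
    (hp2 : 0 < p2) (hd3 : 0 < d3) (hk : 0 < k)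
    (u1 u2 u3 : ℝ → ℝ)
    (hpos : ∀ t ≥ (0 : ℝ), 0 < u1 t ∧ 0 < u2 t ∧ 0 < u3 t)
    (h1 : ∀ t ≥ (0 : ℝ), HasDerivWithinAt u1
      ((2 * a1 / (1 + k * u3 t) - 1) * u1 t) (Set.Ici 0) t)
    (h2 : ∀ t ≥ (0 : ℝ), HasDerivWithinAt u2
      ((2 * a2 / (1 + k * u3 t) - 1) * p2 * u2 t
        + 2 * (1 - a1 / (1 + k * u3 t)) * u1 t) (Set.Ici 0) t)
    (h3 : ∀ t ≥ (0 : ℝ), HasDerivWithinAt u3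
      (2 * (1 - a2 / (1 + k * u3 t)) * p2 * u2 t - d3 * u3 t) (Set.Ici 0) t) :
    ∃ C1 C2 C3 : ℝ, ∀ t ≥ (0 : ℝ), u1 t ≤ C1 ∧ u2 t ≤ C2 ∧ u3 t ≤ C3 := by
  obtain ⟨ha1p, ha1l⟩ := ha1
  obtain ⟨ha2p, ha2l⟩ := ha2
  obtain ⟨s, hs⟩ : ∃ s : ℝ → ℝ, ∀ t, s t = 1 / (1 + k * u3 t) := ⟨_, fun _ => rfl⟩
  have e : ∀ a t, a / (1 + k * u3 t) = a * s t := fun a t => by rw [hs]; ring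
  simp only [e] at h1 h2 h3
  have hsp : ∀ t ≥ (0 : ℝ), 0 < s t := fun t ht => by
    have := mul_pos hk (hpos t ht).2.2
    rw [hs]; positivity
  have hsl : ∀ t ≥ (0 : ℝ), s t < 1 := fun t ht => by
    have := mul_pos hk (hpos t ht).2.2
    rw [hs, div_lt_one (by linarith)]; linarith
  have hsh : ∀ t ≥ (0 : ℝ), 1 / k ≤ u3 t → s t ≤ 1 / 2 := fun t ht h => by
    rw [div_le_iff₀ hk] at h
    rw [hs]
    exact one_div_le_one_div_of_le (by norm_num) (by linarith)
  have hb : ∀ a, 0 < a → a < 1 → ∀ t ≥ (0 : ℝ), 0 < a * s t ∧ a * s t < a := fun a h h' t ht =>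
    ⟨mul_pos h (hsp t ht), by nlinarith [hsl t ht]⟩
  -- Step 1: `u1 ≤ M * u2`
  obtain ⟨M, hM0, hMi, hM⟩ : ∃ M : ℝ, 0 < M ∧ u1 0 ≤ M * u2 0 ∧ 1 + p2 < 2 * M * (1 - a1) := by
    refine ⟨max (u1 0 / u2 0) ((1 + p2) / (1 - a1)), ?_, ?_, ?_⟩
    · exact lt_max_of_lt_left (div_pos (hpos 0 le_rfl).1 (hpos 0 le_rfl).2.1)
    · rw [← div_le_iff₀ (hpos 0 le_rfl).2.1]; exact le_max_left _ _
    · have := le_max_right (u1 0 / u2 0) ((1 + p2) / (1 - a1))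
      rw [div_le_iff₀ (by linarith)] at this
      linarith
  have k1 : ∀ t ≥ (0 : ℝ), u1 t ≤ M * u2 t := by
    have := barrier (fun t => u1 t - M * u2 t) _ 0
      (fun t ht => (h1 t ht).sub ((h2 t ht).const_mul M)) (by simpa using hMi) ?_
    · intro t ht
      have := this t ht
      linarith
    · intro t ht h
      obtain ⟨q1, q2, q3⟩ := hpos t ht
      obtain ⟨b1, b2⟩ := hb a1 ha1p ha1l t ht
      obtain ⟨b3, b4⟩ := hb a2 ha2p ha2l t ht
      have hu : M * u2 t = u1 t := by linarith
      have i1 : (2 * a1 * s t - 1) * u1 t ≤ u1 t := by nlinarith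
      have i2 : -(p2 * u1 t) ≤ (2 * a2 * s t - 1) * p2 * (M * u2 t) := by
        rw [hu]; nlinarith [mul_pos hp2 q1, mul_pos b3 (mul_pos hp2 q1)]
      have i3 : 2 * M * (1 - a1) * u1 t ≤ M * (2 * (1 - a1 * s t) * u1 t) := by
        nlinarith [mul_pos hM0 q1, mul_pos (sub_pos.2 b2) (mul_pos hM0 q1)]
      nlinarith [mul_pos (sub_pos.2 hM) q1]
  -- Step 2: `u2 ≤ N * u3`
  obtain ⟨N, hN0, hNi, hN⟩ : ∃ N : ℝ, 0 < N ∧ u2 0 ≤ N * u3 0 ∧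
      p2 + 2 * M + d3 < 2 * N * ((1 - a2) * p2) := by
    have hq : 0 < (1 - a2) * p2 := mul_pos (by linarith) hp2
    refine ⟨max (u2 0 / u3 0) ((p2 + 2 * M + d3) / ((1 - a2) * p2)), ?_, ?_, ?_⟩
    · exact lt_max_of_lt_left (div_pos (hpos 0 le_rfl).2.1 (hpos 0 le_rfl).2.2)
    · rw [← div_le_iff₀ (hpos 0 le_rfl).2.2]; exact le_max_left _ _
    · have := le_max_right (u2 0 / u3 0) ((p2 + 2 * M + d3) / ((1 - a2) * p2))
      rw [div_le_iff₀ hq] at this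
      linarith
  have k2 : ∀ t ≥ (0 : ℝ), u2 t ≤ N * u3 t := by
    have := barrier (fun t => u2 t - N * u3 t) _ 0
      (fun t ht => (h2 t ht).sub ((h3 t ht).const_mul N)) (by simpa using hNi) ?_
    · intro t ht
      have := this t ht
      linarith
    · intro t ht h
      obtain ⟨q1, q2, q3⟩ := hpos t ht
      obtain ⟨b1, b2⟩ := hb a1 ha1p ha1l t ht
      obtain ⟨b3, b4⟩ := hb a2 ha2p ha2l t ht
      have hu : N * u3 t = u2 t := by linarith
      have hpu := mul_pos hp2 q2
      have i1 : (2 * a2 * s t - 1) * p2 * u2 t ≤ p2 * u2 t := by nlinarith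
      have i2 : 2 * (1 - a1 * s t) * u1 t ≤ 2 * M * u2 t := by
        nlinarith [k1 t ht, mul_pos b1 q1]
      have i3 : 2 * N * ((1 - a2) * p2) * u2 t ≤ N * (2 * (1 - a2 * s t) * p2 * u2 t) := by
        nlinarith [mul_pos (sub_pos.2 b4) (mul_pos hN0 hpu)]
      have i4 : N * (d3 * u3 t) = d3 * u2 t := by rw [← hu]; ring
      nlinarith [mul_pos (sub_pos.2 hN) q2]
  -- Step 3: bound for `u1`
  obtain ⟨C1, hC1i, hC1⟩ : ∃ C : ℝ, u1 0 ≤ C ∧ M * N / k ≤ C :=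
    ⟨_, le_max_left _ _, le_max_right _ _⟩
  have m1 : ∀ t ≥ (0 : ℝ), u1 t ≤ C1 := by
    refine barrier u1 _ C1 h1 hC1i ?_
    intro t ht h
    obtain ⟨q1, q2, q3⟩ := hpos t ht
    have h3' : 1 / k ≤ u3 t := by
      have i1 : M * u2 t ≤ M * (N * u3 t) := mul_le_mul_of_nonneg_left (k2 t ht) hM0.le
      have i2 : (M * N) * (1 / k) ≤ (M * N) * u3 t := by
        have : (M * N) * (1 / k) = M * N / k := by ring
        linarith [k1 t ht]
      exact le_of_mul_le_mul_left i2 (mul_pos hM0 hN0)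
    have := hsh t ht h3'
    exact mul_neg_of_neg_of_pos (by nlinarith) q1
  -- Step 4: bound for `u2`
  have hq : 0 < (1 - a2) * p2 := mul_pos (by linarith) hp2
  obtain ⟨C2, hC2i, hC2, hC2'⟩ : ∃ C : ℝ, u2 0 ≤ C ∧ N / k ≤ C ∧
      (2 * C1 + 1) / ((1 - a2) * p2) ≤ C :=
    ⟨max (u2 0) (max (N / k) ((2 * C1 + 1) / ((1 - a2) * p2))), le_max_left _ _,
      (le_max_left _ _).trans (le_max_right _ _), (le_max_right _ _).trans (le_max_right _ _)⟩
  rw [div_le_iff₀ hq] at hC2'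
  have m2 : ∀ t ≥ (0 : ℝ), u2 t ≤ C2 := by
    refine barrier u2 _ C2 h2 hC2i ?_
    intro t ht h
    obtain ⟨q1, q2, q3⟩ := hpos t ht
    obtain ⟨b1, b2⟩ := hb a1 ha1p ha1l t ht
    have h3' : 1 / k ≤ u3 t := by
      have i2 : N * (1 / k) ≤ N * u3 t := by
        have : N * (1 / k) = N / k := by ring
        linarith [k2 t ht]
      exact le_of_mul_le_mul_left i2 hN0
    have hs2 := hsh t ht h3'
    have i0 : 2 * a2 * s t ≤ a2 := by nlinarith
    have i1 : (2 * a2 * s t - 1) * p2 * u2 t ≤ -(C2 * ((1 - a2) * p2)) := by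
      rw [← h]
      nlinarith [mul_le_mul_of_nonneg_right i0 (mul_pos hp2 q2).le]
    have i2 : 2 * (1 - a1 * s t) * u1 t ≤ 2 * C1 := by
      nlinarith [m1 t ht, mul_pos b1 q1]
    linarith
  -- Step 5: bound for `u3`
  obtain ⟨C3, hC3i, hC3⟩ : ∃ C : ℝ, u3 0 ≤ C ∧ (2 * p2 * C2 + 1) / d3 ≤ C :=
    ⟨_, le_max_left _ _, le_max_right _ _⟩
  rw [div_le_iff₀ hd3] at hC3
  have m3 : ∀ t ≥ (0 : ℝ), u3 t ≤ C3 := by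
    refine barrier u3 _ C3 h3 hC3i ?_
    intro t ht h
    obtain ⟨q1, q2, q3⟩ := hpos t ht
    obtain ⟨b3, b4⟩ := hb a2 ha2p ha2l t ht
    have i1 : 2 * (1 - a2 * s t) * p2 * u2 t ≤ 2 * p2 * C2 := by
      nlinarith [mul_le_mul_of_nonneg_left (m2 t ht) hp2.le, mul_pos b3 (mul_pos hp2 q2)]
    rw [h]
    linarith
  exact ⟨C1, C2, C3, fun t ht => ⟨m1 t ht, m2 t ht, m3 t ht⟩⟩
end

section
/- Let a1, a2 ∈ (0,1), p2 > 0, d3 > 0, k > 0, and let u1, u2, u3 : [0,∞) → ℝ be a differentiable solution of the dimensionless three-compartment hematopoiesis model with u1(t) > 0, u2(t) > 0, u3(t) > 0 for all t ≥ 0. Then the ratio v1(t) := u1(t)/u2(t) satisfies v1(t) ≤ max{ (1+p2)/(2(1−a1)), v1(0) } for all t ≥ 0. -/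
/-- For a positive solution of the dimensionless three-compartment
hematopoiesis model, the ratio `v1 = u1/u2` stays below
`max ((1+p2)/(2(1−a1))) (v1 0)` for all `t ≥ 0`. -/
theorem stmt_2 (a1 a2 p2 d3 k : ℝ)
    (ha1 : a1 ∈ Set.Ioo (0 : ℝ) 1) (ha2 : a2 ∈ Set.Ioo (0 : ℝ) 1)
    (hp2 : 0 < p2) (hd3 : 0 < d3) (hk : 0 < k)
    (u1 u2 u3 : ℝ → ℝ)
    (hpos : ∀ t ≥ (0 : ℝ), 0 < u1 t ∧ 0 < u2 t ∧ 0 < u3 t)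
    (h1 : ∀ t ≥ (0 : ℝ), HasDerivWithinAt u1
      ((2 * a1 / (1 + k * u3 t) - 1) * u1 t) (Set.Ici 0) t)
    (h2 : ∀ t ≥ (0 : ℝ), HasDerivWithinAt u2
      ((2 * a2 / (1 + k * u3 t) - 1) * p2 * u2 t
        + 2 * (1 - a1 / (1 + k * u3 t)) * u1 t) (Set.Ici 0) t)
    (h3 : ∀ t ≥ (0 : ℝ), HasDerivWithinAt u3
      (2 * (1 - a2 / (1 + k * u3 t)) * p2 * u2 t - d3 * u3 t) (Set.Ici 0) t) :
    ∀ t ≥ (0 : ℝ),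
      u1 t / u2 t ≤ max ((1 + p2) / (2 * (1 - a1))) (u1 0 / u2 0) := by
  intro t ht
  obtain ⟨ha1p, ha1l⟩ := ha1
  obtain ⟨ha2p, ha2l⟩ := ha2
  set M := max ((1 + p2) / (2 * (1 - a1))) (u1 0 / u2 0) with hM
  have hd : ∀ x ≥ (0 : ℝ), HasDerivWithinAt (fun x => u1 x / u2 x)
      ((((2 * a1 / (1 + k * u3 x) - 1) * u1 x) * u2 x - u1 x *
        ((2 * a2 / (1 + k * u3 x) - 1) * p2 * u2 x
          + 2 * (1 - a1 / (1 + k * u3 x)) * u1 x)) / (u2 x) ^ 2) (Set.Ici 0) x :=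
    fun x hx => (h1 x hx).div (h2 x hx) (hpos x hx).2.1.ne'
  refine image_le_of_deriv_right_lt_deriv_boundary (f := fun x => u1 x / u2 x)
    (a := 0) (b := t) (B := fun _ => M) (B' := fun _ => 0)
    (fun x hx => ((hd x hx.1).continuousWithinAt).mono (fun y hy => hy.1))
    (fun x hx => (hd x hx.1).mono (Set.Ici_subset_Ici.2 hx.1))
    (le_max_right _ _) (fun x => hasDerivAt_const x M) ?_ (Set.right_mem_Icc.2 ht)
  intro x hx hv
  obtain ⟨p1, q2, q3⟩ := hpos x hx.1
  have hMl : (1 + p2) / (2 * (1 - a1)) ≤ u1 x / u2 x := by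
    have : u1 x / u2 x = M := hv
    rw [this]; exact le_max_left _ _
  rw [div_le_div_iff₀ (by linarith) q2] at hMl
  have hD : 1 < 1 + k * u3 x := by nlinarith [mul_pos hk q3]
  obtain ⟨s, hs⟩ : ∃ s, s = (1 + k * u3 x)⁻¹ := ⟨_, rfl⟩
  have hs0 : 0 < s := by rw [hs]; positivity
  have hs1 : s < 1 := by rw [hs]; exact inv_lt_one_of_one_lt₀ hD
  simp only [div_eq_mul_inv _ (1 + k * u3 x), ← hs]
  apply div_neg_of_neg_of_pos _ (by positivity)
  have e1 : a1 * s < a1 := by nlinarith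
  have e2 : 0 < a2 * s * p2 := by positivity
  have e3 : u1 x * (2 * (1 - a1)) ≤ u1 x * (2 * (1 - a1 * s)) :=
    mul_le_mul_of_nonneg_left (by linarith) p1.le
  have e4 : (2 * (a1 * s) - 1 + p2 - 2 * (a2 * s * p2)) * u2 x < (1 + p2) * u2 x :=
    mul_lt_mul_of_pos_right (by linarith) q2
  have e5 : 0 < u1 x * (u1 x * (2 * (1 - a1 * s)) -
      (2 * (a1 * s) - 1 + p2 - 2 * (a2 * s * p2)) * u2 x) :=
    mul_pos p1 (by linarith)
  linarith
end

section
/- Let a1, a2 ∈ (0,1), p2 > 0, d3 > 0, k > 0. The dimensionless three-compartment hematopoiesis model has a steady state of the form (0, ū2, ū3) with ū2 > 0 and ū3 > 0 if and only if a2 > 1/2; in this case the semi-trivial steady state is unique and equals E1 = (0, (d3/p2)·(2a2−1)/k, (2a2−1)/k). -/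
/-- A point is a steady state of the dimensionless three-compartment
hematopoiesis model iff all three right-hand sides vanish there. -/
def IsSteadyState (a1 a2 p2 d3 k x y z : ℝ) : Prop :=
  (2 * a1 / (1 + k * z) - 1) * x = 0 ∧
  (2 * a2 / (1 + k * z) - 1) * p2 * y + 2 * (1 - a1 / (1 + k * z)) * x = 0 ∧
  2 * (1 - a2 / (1 + k * z)) * p2 * y - d3 * z = 0

/-- **Existence and uniqueness of the semi-trivial steady state `E1`**:
a steady state of the form `(0, ū2, ū3)` with `ū2, ū3 > 0` exists iff
`a2 > 1/2`, and in that case it equals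
`E1 = (0, (d3/p2)·(2a2−1)/k, (2a2−1)/k)`. -/
theorem stmt_4 (a1 a2 p2 d3 k : ℝ)
    (ha1 : a1 ∈ Set.Ioo (0 : ℝ) 1) (ha2 : a2 ∈ Set.Ioo (0 : ℝ) 1)
    (hp2 : 0 < p2) (hd3 : 0 < d3) (hk : 0 < k) :
    ((∃ y z : ℝ, 0 < y ∧ 0 < z ∧ IsSteadyState a1 a2 p2 d3 k 0 y z) ↔
      a2 > 1 / 2) ∧
    (∀ y z : ℝ, 0 < y → 0 < z → IsSteadyState a1 a2 p2 d3 k 0 y z →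
      y = d3 / p2 * ((2 * a2 - 1) / k) ∧ z = (2 * a2 - 1) / k) := by
  have key : ∀ y z : ℝ, 0 < y → 0 < z → IsSteadyState a1 a2 p2 d3 k 0 y z →
      2 * a2 = 1 + k * z ∧ p2 * y = d3 * z := by
    intro y z hy hz h
    obtain ⟨-, h2, h3⟩ := h
    have hpos : 0 < 1 + k * z := by positivity
    have hpy : p2 * y ≠ 0 := by positivity
    have h4 : (2 * a2 / (1 + k * z) - 1) * (p2 * y) = 0 := by linarith
    have h5 : 2 * a2 / (1 + k * z) - 1 = 0 :=
      (mul_eq_zero.mp h4).resolve_right hpy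
    have h6 : 2 * (a2 / (1 + k * z)) = 1 := by
      rw [← mul_div_assoc]; linarith
    refine ⟨?_, ?_⟩
    · have h7 : 2 * a2 / (1 + k * z) = 1 := by linarith
      rw [div_eq_iff hpos.ne'] at h7
      linarith
    · have h8 : a2 / (1 + k * z) = 1 / 2 := by linarith
      rw [h8] at h3
      linarith
  refine ⟨⟨?_, ?_⟩, ?_⟩
  · rintro ⟨y, z, hy, hz, h⟩
    have h1 := (key y z hy hz h).1
    have : 0 < k * z := by positivity
    show 1 / 2 < a2
    linarith
  · intro h
    have h0 : 0 < 2 * a2 - 1 := by linarith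
    have ha : a2 ≠ 0 := ha2.1.ne'
    have hkz : 1 + k * ((2 * a2 - 1) / k) = 2 * a2 := by
      field_simp; ring
    have hhalf : a2 / (2 * a2) = 1 / 2 := by field_simp
    have hone : 2 * a2 / (2 * a2) = 1 := by field_simp
    refine ⟨d3 / p2 * ((2 * a2 - 1) / k), (2 * a2 - 1) / k, by positivity,
      by positivity, ?_⟩
    unfold IsSteadyState
    rw [hkz, hhalf, hone]
    refine ⟨by ring, by ring, ?_⟩
    field_simp
    ring
  · intro y z hy hz h
    obtain ⟨h1, h2⟩ := key y z hy hz h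
    have hz' : z = (2 * a2 - 1) / k := by
      rw [eq_div_iff hk.ne']; linarith
    refine ⟨?_, hz'⟩
    rw [← hz']
    field_simp
    linarith
end

section
/- Let a1, a2 ∈ (0,1), p2 > 0, d3 > 0, k > 0. The dimensionless three-compartment hematopoiesis model has a steady state (ū1, ū2, ū3) with all three components strictly positive if and only if a1 > 1/2 and a2 < a1; in this case the positive steady state is unique and equals E2 = (ū1, ū2, ū3) with ū3 = (2a1−1)/k, ū2 = d3·ū3 / ((2 − a2/a1)·p2), and ū1 = (1 − a2/a1)·p2·ū2. -/
/-- **Existence and uniqueness of the positive steady state `E2`**: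
a strictly positive steady state exists iff `a1 > 1/2` and `a2 < a1`,
and in that case it equals `E2` with `ū3 = (2a1−1)/k`,
`ū2 = d3·ū3/((2 − a2/a1)·p2)` and `ū1 = (1 − a2/a1)·p2·ū2`. -/
theorem stmt_5 (a1 a2 p2 d3 k : ℝ)
    (ha1 : a1 ∈ Set.Ioo (0 : ℝ) 1) (ha2 : a2 ∈ Set.Ioo (0 : ℝ) 1)
    (hp2 : 0 < p2) (hd3 : 0 < d3) (hk : 0 < k) :
    ((∃ x y z : ℝ, 0 < x ∧ 0 < y ∧ 0 < z ∧
        IsSteadyState a1 a2 p2 d3 k x y z) ↔ (a1 > 1 / 2 ∧ a2 < a1)) ∧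
    (∀ x y z : ℝ, 0 < x → 0 < y → 0 < z →
      IsSteadyState a1 a2 p2 d3 k x y z →
      z = (2 * a1 - 1) / k ∧
      y = d3 * z / ((2 - a2 / a1) * p2) ∧
      x = (1 - a2 / a1) * p2 * y) := by
  obtain ⟨h1, -⟩ := ha1
  have hA : 2 * a2 / (2 * a1) = a2 / a1 := by field_simp
  have hB : a1 / (2 * a1) = 1 / 2 := by field_simp
  have hC : a2 / (2 * a1) = a2 / a1 / 2 := by field_simp
  have key : ∀ x y z : ℝ, 0 < x → 0 < y → 0 < z →
      IsSteadyState a1 a2 p2 d3 k x y z →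
      1 + k * z = 2 * a1 ∧ x = (1 - a2 / a1) * p2 * y ∧
        (2 - a2 / a1) * p2 * y = d3 * z ∧ a2 / a1 < 1 := by
    rintro x y z hx hy hz ⟨e1, e2, e3⟩
    have hpos : 0 < 1 + k * z := by positivity
    have e : 1 + k * z = 2 * a1 := by
      rcases mul_eq_zero.mp e1 with h | h
      · have h' : 2 * a1 / (1 + k * z) = 1 := by linarith
        rw [div_eq_one_iff_eq hpos.ne'] at h'
        exact h'.symm
      · exact absurd h hx.ne'
    rw [e, hA, hB] at e2
    rw [e, hC] at e3
    have ex : x = (1 - a2 / a1) * p2 * y := by linarith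
    refine ⟨e, ex, by linarith, ?_⟩
    by_contra hr
    have h3 : 0 ≤ (a2 / a1 - 1) * (p2 * y) :=
      mul_nonneg (by linarith) (by positivity)
    nlinarith
  refine ⟨⟨?_, ?_⟩, ?_⟩
  · rintro ⟨x, y, z, hx, hy, hz, h⟩
    obtain ⟨e, -, -, hr⟩ := key x y z hx hy hz h
    have := mul_pos hk hz
    exact ⟨by linarith, (div_lt_one h1).mp hr⟩
  · rintro ⟨h, h'⟩
    have hr : a2 / a1 < 1 := (div_lt_one h1).mpr h'
    have hr1 : 0 < 1 - a2 / a1 := by linarith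
    have hr2 : 0 < 2 - a2 / a1 := by linarith
    have hz : 0 < (2 * a1 - 1) / k := div_pos (by linarith) hk
    have e : 1 + k * ((2 * a1 - 1) / k) = 2 * a1 := by field_simp; ring
    generalize (2 * a1 - 1) / k = z at hz e
    have hy : 0 < d3 * z / ((2 - a2 / a1) * p2) := by positivity
    have ey : (2 - a2 / a1) * p2 * (d3 * z / ((2 - a2 / a1) * p2)) = d3 * z :=
      mul_div_cancel₀ _ (by positivity)
    generalize d3 * z / ((2 - a2 / a1) * p2) = y at hy ey
    refine ⟨(1 - a2 / a1) * p2 * y, y, z, by positivity, hy, hz, ?_, ?_, ?_⟩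
    · rw [e, div_self (by positivity)]; ring
    · rw [e, hA, hB]; ring
    · rw [e, hC]; linarith
  · intro x y z hx hy hz h
    obtain ⟨e, ex, ey, hr⟩ := key x y z hx hy hz h
    have hr2 : 0 < 2 - a2 / a1 := by linarith
    refine ⟨?_, ?_, ex⟩
    · rw [eq_div_iff hk.ne']; linarith
    · rw [eq_div_iff (by positivity)]; linarith
end

section
/- Let a1 ∈ (0,1), a2 ∈ (1/2, 1), p2 > 0, d3 > 0, and consider the Jacobian matrix of the dimensionless three-compartment hematopoiesis model at the semi-trivial steady state E1, J1 = [[a1/a2 − 1, 0, 0], [2 − a1/a2, 0, −(1 − 1/(2a2))·d3], [0, p2, −d3/(2a2)]]. If a1 < a2 then every complex eigenvalue of J1 has negative real part; if a1 > a2 then J1 has an eigenvalue with positive real part. -/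
open Polynomial Matrix

/-- Evaluation of the characteristic polynomial of a matrix of the shape of `J1`. -/
lemma J1_isRoot_iff (A x b p c : ℝ) (μ : ℂ) :
    ((!![A, 0, 0; x, 0, -b; 0, p, -c] : Matrix (Fin 3) (Fin 3) ℝ).map
      Complex.ofReal).charpoly.IsRoot μ ↔
    (μ - A) * (μ * (μ + c) + b * p) = 0 := by
  rw [Polynomial.IsRoot.def, Matrix.eval_charpoly, Matrix.det_fin_three]
  simp [Matrix.scalar_apply, Matrix.diagonal]
  grind

/-- Roots of a real quadratic with positive coefficients have negative real part. -/
lemma quadratic_root_re_neg (c q : ℝ) (hc : 0 < c) (hq : 0 < q) (μ : ℂ)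
    (h : μ * (μ + c) + q = 0) : μ.re < 0 := by
  have h1 := congrArg Complex.re h
  have h2 := congrArg Complex.im h
  simp at h1 h2
  by_contra! hn
  have h3 : μ.im * (2 * μ.re + c) = 0 := by linarith
  rcases mul_eq_zero.mp h3 with h4 | h4
  · rw [h4] at h1
    nlinarith [mul_nonneg hn hc.le, mul_nonneg hn hn]
  · linarith

/-- **Stability of the semi-trivial steady state `E1`**: for `a2 ∈ (1/2,1)`,
the Jacobian at `E1`,
`J1 = [[a1/a2 − 1,0,0],[2 − a1/a2,0,−(1 − 1/(2a2))d3],[0,p2,−d3/(2a2)]]`,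
has only eigenvalues with negative real part if `a1 < a2`, and has an
eigenvalue with positive real part if `a1 > a2`. -/
theorem stmt_8 (a1 a2 p2 d3 : ℝ)
    (ha1 : a1 ∈ Set.Ioo (0 : ℝ) 1) (ha2 : a2 ∈ Set.Ioo (1 / 2 : ℝ) 1)
    (hp2 : 0 < p2) (hd3 : 0 < d3) :
    (a1 < a2 →
      ∀ μ : ℂ,
      ((!![a1 / a2 - 1, 0, 0;
           2 - a1 / a2, 0, -((1 - 1 / (2 * a2)) * d3);
           0, p2, -(d3 / (2 * a2))] : Matrix (Fin 3) (Fin 3) ℝ).map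
        Complex.ofReal).charpoly.IsRoot μ → μ.re < 0) ∧
    (a1 > a2 →
      ∃ μ : ℂ,
      ((!![a1 / a2 - 1, 0, 0;
           2 - a1 / a2, 0, -((1 - 1 / (2 * a2)) * d3);
           0, p2, -(d3 / (2 * a2))] : Matrix (Fin 3) (Fin 3) ℝ).map
        Complex.ofReal).charpoly.IsRoot μ ∧ 0 < μ.re) := by
  obtain ⟨h1, h2⟩ := ha2
  have h0 : 0 < a2 := by linarith
  have hc : 0 < d3 / (2 * a2) := by positivity
  have hb : 0 < (1 - 1 / (2 * a2)) * d3 := by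
    refine mul_pos ?_ hd3
    rw [sub_pos, div_lt_one (by positivity)]
    linarith
  constructor
  · intro hlt μ hμ
    rw [J1_isRoot_iff] at hμ
    rcases mul_eq_zero.mp hμ with h | h
    · rw [sub_eq_zero.mp h, Complex.ofReal_re, sub_neg, div_lt_one h0]
      exact hlt
    · refine quadratic_root_re_neg _ _ hc (mul_pos hb hp2) μ ?_
      rw [Complex.ofReal_mul]
      exact h
  · intro hgt
    refine ⟨((a1 / a2 - 1 : ℝ) : ℂ), ?_, ?_⟩
    · rw [J1_isRoot_iff, sub_self, zero_mul]
    · rw [Complex.ofReal_re, sub_pos, one_lt_div h0]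
      exact hgt
end

section
/- Let a1 ∈ (1/2, 1), a2 ∈ (0, a1), p2 > 0, d3 > 0. The characteristic polynomial of the Jacobian matrix J2 of the dimensionless three-compartment hematopoiesis model at the positive steady state E2 equals λ³ + b1·λ² + b2·λ + b3, where b1 = (1 − a2/a1)·p2 + (1 − (a2/a1)(1 − 1/(2a1))/(2 − a2/a1))·d3, b2 = [(1 − a2/a1)·(1 − (a2/a1)(1 − 1/(2a1))/(2 − a2/a1)) − (1 − 1/(2a1))·(1 − 2a2/a1)]·d3·p2, and b3 = (1 − 1/(2a1))·(1 − a2/a1)·d3·p2. -/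
open Polynomial Matrix

theorem charpoly_aux (u v w s t : ℝ) :
    (!![0, 0, -u; 1, -v, w; 0, s, t] : Matrix (Fin 3) (Fin 3) ℝ).charpoly =
      X ^ 3 + C (v - t) * X ^ 2 + C (-(v * t) - w * s) * X + C (u * s) := by
  rw [Matrix.charpoly, Matrix.det_fin_three]
  simp [Matrix.charmatrix_apply]
  ring

/-- **Characteristic polynomial of the Jacobian at the positive steady state
`E2`**: it equals `λ³ + b1λ² + b2λ + b3` with the coefficients `b1, b2, b3`
given in the paper. -/
theorem stmt_9 (a1 a2 p2 d3 : ℝ)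
    (ha1 : a1 ∈ Set.Ioo (1 / 2 : ℝ) 1) (ha2 : a2 ∈ Set.Ioo (0 : ℝ) a1)
    (hp2 : 0 < p2) (hd3 : 0 < d3) :
    (!![0, 0, -((1 - 1 / (2 * a1)) * (1 - a2 / a1) * d3 / (2 - a2 / a1));
        1, -((1 - a2 / a1) * p2),
          (1 - 1 / (2 * a1)) * (1 - 2 * (a2 / a1)) * d3 / (2 - a2 / a1);
        0, (2 - a2 / a1) * p2,
          ((a2 / a1) * (1 - 1 / (2 * a1)) / (2 - a2 / a1) - 1) * d3] :
      Matrix (Fin 3) (Fin 3) ℝ).charpoly =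
    X ^ 3
      + C ((1 - a2 / a1) * p2
          + (1 - (a2 / a1) * (1 - 1 / (2 * a1)) / (2 - a2 / a1)) * d3) * X ^ 2
      + C (((1 - a2 / a1) * (1 - (a2 / a1) * (1 - 1 / (2 * a1)) / (2 - a2 / a1))
            - (1 - 1 / (2 * a1)) * (1 - 2 * (a2 / a1))) * d3 * p2) * X
      + C ((1 - 1 / (2 * a1)) * (1 - a2 / a1) * d3 * p2) := by
  obtain ⟨h1, _⟩ := ha1
  obtain ⟨_, h4⟩ := ha2
  have hpos : 0 < a1 := by linarith
  have hlt : a2 / a1 < 1 := (div_lt_one hpos).2 h4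
  have hne : 2 - a2 / a1 ≠ 0 := by linarith
  rw [charpoly_aux]
  generalize a2 / a1 = r at *
  generalize 1 - 1 / (2 * a1) = q at *
  congr 1
  · congr 1
    · congr 3
      ring
    · congr 2
      field_simp
      ring
  · congr 1
    field_simp
end

section
/- Let a1 ∈ (1/2, 1), a2 ∈ (0, a1), p2 > 0, d3 > 0, and set b1, b2, b3 to be the characteristic-polynomial coefficients of the Jacobian at E2 and p2* := (1/(1 − a2/a1))·( 1/γ(a1,a2) − β(a1,a2)·d3 ). Then b1·b2 − b3 > 0 if and only if p2 > p2*, b1·b2 − b3 = 0 if and only if p2 = p2*, and b1·b2 − b3 < 0 if and only if p2 < p2*. -/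
/-- **Sign of the Routh–Hurwitz quantity `b1·b2 − b3` at `E2` relative to the
critical proliferation rate** `p2* = (1/(1 − a2/a1))·(1/γ − β·d3)`:
`b1·b2 − b3` is positive/zero/negative exactly when `p2` is
greater than/equal to/less than `p2*`. -/
theorem stmt_12 (a1 a2 p2 d3 : ℝ)
    (ha1 : a1 ∈ Set.Ioo (1 / 2 : ℝ) 1) (ha2 : a2 ∈ Set.Ioo (0 : ℝ) a1)
    (hp2 : 0 < p2) (hd3 : 0 < d3) :
    let b1 : ℝ := (1 - a2 / a1) * p2
        + (1 - (a2 / a1) * (1 - 1 / (2 * a1)) / (2 - a2 / a1)) * d3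
    let b2 : ℝ := ((1 - a2 / a1)
          * (1 - (a2 / a1) * (1 - 1 / (2 * a1)) / (2 - a2 / a1))
        - (1 - 1 / (2 * a1)) * (1 - 2 * (a2 / a1))) * d3 * p2
    let b3 : ℝ := (1 - 1 / (2 * a1)) * (1 - a2 / a1) * d3 * p2
    let beta : ℝ := 1 - (a2 / a1) * (1 - 1 / (2 * a1)) / (2 - a2 / a1)
    let gam : ℝ := (1 / (2 * a1)) / (1 - 1 / (2 * a1))
        + (a2 / a1) / ((2 - a2 / a1) * (1 - a2 / a1))
    let p2star : ℝ := 1 / (1 - a2 / a1) * (1 / gam - beta * d3)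
    (0 < b1 * b2 - b3 ↔ p2star < p2) ∧
    (b1 * b2 - b3 = 0 ↔ p2 = p2star) ∧
    (b1 * b2 - b3 < 0 ↔ p2 < p2star) := by
  obtain ⟨h1, h2⟩ := ha1
  obtain ⟨h3, h4⟩ := ha2
  have ha : 0 < a1 := by linarith
  have hx0 : 0 < a2 / a1 := div_pos h3 ha
  have hx1 : a2 / a1 < 1 := (div_lt_one ha).2 h4
  have hq0 : 0 < 1 / (2 * a1) := by positivity
  have hq1 : 1 / (2 * a1) < 1 := by
    rw [div_lt_one (by positivity)]
    linarith
  generalize a2 / a1 = x at *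
  generalize 1 / (2 * a1) = q at *
  intro b1 b2 b3 beta gam p2star
  have hk : 0 < 1 - q := by linarith
  have hx : 0 < 1 - x := by linarith
  have hx2 : 0 < 2 - x := by linarith
  have hg : 0 < gam := by
    have e1 : 0 < q / (1 - q) := div_pos hq0 hk
    have e2 : 0 < x / ((2 - x) * (1 - x)) := div_pos hx0 (mul_pos hx2 hx)
    exact add_pos e1 e2
  have hb2 : b2 = (1 - q) * (1 - x) * gam * d3 * p2 := by
    simp only [b2, gam]
    field_simp
    ring
  have hs : (1 - x) * gam * p2star = 1 - beta * d3 * gam := by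
    simp only [p2star]
    generalize gam = g at *
    field_simp
  have key : b1 * b2 - b3
      = ((1 - q) * (1 - x) * (1 - x) * gam * d3 * p2) * (p2 - p2star) := by
    have hb1 : b1 = (1 - x) * p2 + beta * d3 := rfl
    have hb3 : b3 = (1 - q) * (1 - x) * d3 * p2 := rfl
    rw [hb2, hb1, hb3]
    linear_combination (1 - q) * (1 - x) * d3 * p2 * hs
  have hc : 0 < (1 - q) * (1 - x) * (1 - x) * gam * d3 * p2 := by positivity
  rw [key]
  refine ⟨?_, ?_, ?_⟩
  · rw [mul_pos_iff_of_pos_left hc, sub_pos]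
  · rw [mul_eq_zero, or_iff_right hc.ne', sub_eq_zero]
  · rw [← neg_pos, ← mul_neg, mul_pos_iff_of_pos_left hc, neg_sub, sub_pos]
end

section
/- Let a1 ∈ (1/2, 1), a2 ∈ (0, a1), p2 > 0, d3 > 0, and let J2 be the Jacobian matrix of the dimensionless three-compartment hematopoiesis model at the positive steady state E2. If p2 > p2* := (1/(1 − a2/a1))·(1/γ(a1,a2) − β(a1,a2)·d3), then every complex eigenvalue of J2 has negative real part. If p2 < p2*, then J2 has an eigenvalue with positive real part. -/
open Polynomial Matrix

lemma cubic_stable (a b c : ℝ) (ha : 0 < a) (hb : 0 < b) (hc : 0 < c) (h : c < a * b) (z : ℂ)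
    (hz : z ^ 3 + a * z ^ 2 + b * z + c = 0) : z.re < 0 := by
  by_contra hx
  push Not at hx
  obtain ⟨x, y⟩ := z
  have h1 := congrArg Complex.re hz
  have h2 := congrArg Complex.im hz
  simp [pow_succ] at h1 h2 hx
  have h3 : y * (3 * x ^ 2 - y ^ 2 + 2 * a * x + b) = 0 := by linear_combination h2
  have p1 : 0 ≤ x ^ 3 := by positivity
  have p2 : 0 ≤ a * x ^ 2 := by positivity
  have p3 : 0 ≤ b * x := by positivity
  have p4 : 0 ≤ a ^ 2 * x := by positivity
  rcases mul_eq_zero.1 h3 with h4 | h4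
  · subst h4
    nlinarith
  · have h5 : -8 * x ^ 3 - 8 * (a * x ^ 2) - 2 * (b * x) - 2 * (a ^ 2 * x) + c - a * b = 0 := by
      linear_combination h1 - (3 * x + a) * h4
    linarith

lemma cubic_unstable (a b c : ℝ) (ha : 0 < a) (hb : 0 < b) (hc : 0 < c) (h : a * b < c) :
    ∃ z : ℂ, z ^ 3 + a * z ^ 2 + b * z + c = 0 ∧ 0 < z.re := by
  have hcb : 0 < c / b := by positivity
  have hbc : b * (c / b) = c := by field_simp
  have hcont : ContinuousOn (fun x : ℝ => 8 * x ^ 3 + 8 * a * x ^ 2 + 2 * (a ^ 2 + b) * x + a * b - c)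
      (Set.Icc 0 (c / b)) := by fun_prop
  have hmem := intermediate_value_Icc hcb.le hcont
  have h0 : (0 : ℝ) ∈ Set.Icc
      ((fun x : ℝ => 8 * x ^ 3 + 8 * a * x ^ 2 + 2 * (a ^ 2 + b) * x + a * b - c) 0)
      ((fun x : ℝ => 8 * x ^ 3 + 8 * a * x ^ 2 + 2 * (a ^ 2 + b) * x + a * b - c) (c / b)) := by
    constructor
    · simp; linarith
    · have q1 : 0 < 8 * (c / b) ^ 3 := by positivity
      have q2 : 0 < 8 * a * (c / b) ^ 2 := by positivity
      have q3 : 0 < a ^ 2 * (c / b) := by positivity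
      have q4 : 0 < a * b := by positivity
      simp only
      linarith
  obtain ⟨x, hx, hgx⟩ := hmem h0
  simp only at hgx
  have hx0 : 0 < x := by
    rcases hx.1.lt_or_eq with h1 | h1
    · exact h1
    · subst h1
      simp at hgx
      linarith
  have hy : (Real.sqrt (3 * x ^ 2 + 2 * a * x + b)) ^ 2 = 3 * x ^ 2 + 2 * a * x + b :=
    Real.sq_sqrt (by positivity)
  set y := Real.sqrt (3 * x ^ 2 + 2 * a * x + b)
  refine ⟨⟨x, y⟩, ?_, hx0⟩
  apply Complex.ext
  · simp [pow_succ]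
    linear_combination -hgx - (3 * x + a) * hy
  · simp [pow_succ]
    linear_combination -y * hy

lemma charpoly_root (A B C D E : ℝ) (z : ℂ) :
    ((!![0, 0, A; 1, B, C; 0, D, E] : Matrix (Fin 3) (Fin 3) ℝ).map Complex.ofReal).charpoly.IsRoot z
      ↔ z ^ 3 + ((-B - E : ℝ) : ℂ) * z ^ 2 + ((B * E - C * D : ℝ) : ℂ) * z
        + ((-A * D : ℝ) : ℂ) = 0 := by
  rw [Polynomial.IsRoot.def, Matrix.eval_charpoly, Matrix.det_fin_three]
  simp
  constructor <;> intro h <;> linear_combination h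

/-- **Linearized stability of the positive steady state `E2`**: if
`p2 > p2* = (1/(1 − a2/a1))·(1/γ − β·d3)` then all complex eigenvalues of the
Jacobian `J2` at `E2` have negative real part; if `p2 < p2*` then `J2` has an
eigenvalue with positive real part. -/
theorem stmt_13 (a1 a2 p2 d3 : ℝ)
    (ha1 : a1 ∈ Set.Ioo (1 / 2 : ℝ) 1) (ha2 : a2 ∈ Set.Ioo (0 : ℝ) a1)
    (hp2 : 0 < p2) (hd3 : 0 < d3) :
    let beta : ℝ := 1 - (a2 / a1) * (1 - 1 / (2 * a1)) / (2 - a2 / a1)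
    let gam : ℝ := (1 / (2 * a1)) / (1 - 1 / (2 * a1))
        + (a2 / a1) / ((2 - a2 / a1) * (1 - a2 / a1))
    let p2star : ℝ := 1 / (1 - a2 / a1) * (1 / gam - beta * d3)
    let J2 : Matrix (Fin 3) (Fin 3) ℝ :=
      !![0, 0, -((1 - 1 / (2 * a1)) * (1 - a2 / a1) * d3 / (2 - a2 / a1));
         1, -((1 - a2 / a1) * p2),
           (1 - 1 / (2 * a1)) * (1 - 2 * (a2 / a1)) * d3 / (2 - a2 / a1);
         0, (2 - a2 / a1) * p2,
           ((a2 / a1) * (1 - 1 / (2 * a1)) / (2 - a2 / a1) - 1) * d3]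
    (p2star < p2 →
      ∀ μ : ℂ, (J2.map Complex.ofReal).charpoly.IsRoot μ → μ.re < 0) ∧
    (p2 < p2star →
      ∃ μ : ℂ, (J2.map Complex.ofReal).charpoly.IsRoot μ ∧ 0 < μ.re) := by
  obtain ⟨h1, h1'⟩ := ha1
  obtain ⟨h2, h2'⟩ := ha2
  have ha1 : 0 < a1 := by linarith
  have hr0 : 0 < a2 / a1 := by positivity
  have hr1 : a2 / a1 < 1 := (div_lt_one ha1).2 h2'
  have hs0 : 0 < 1 / (2 * a1) := by positivity
  have hs1 : 1 / (2 * a1) < 1 := (div_lt_one (by positivity)).2 (by linarith)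
  generalize a2 / a1 = r at hr0 hr1 ⊢
  generalize 1 / (2 * a1) = s at hs0 hs1 ⊢
  intro beta gam p2star J2
  simp only [J2, charpoly_root]
  have hr : 0 < 1 - r := by linarith
  have hr2 : 0 < 2 - r := by linarith
  have hs : 0 < 1 - s := by linarith
  have hgam : 0 < gam := by positivity
  have hbeta : 0 < beta := by
    have : r * (1 - s) / (2 - r) < 1 := by
      rw [div_lt_one hr2]
      nlinarith
    simp only [beta]
    linarith
  have ea : - -((1 - r) * p2) - (r * (1 - s) / (2 - r) - 1) * d3
      = (1 - r) * p2 + beta * d3 := by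
    simp only [beta]; ring
  have ec : - -((1 - s) * (1 - r) * d3 / (2 - r)) * ((2 - r) * p2)
      = (1 - s) * (1 - r) * d3 * p2 := by
    field_simp
  have eb : -((1 - r) * p2) * ((r * (1 - s) / (2 - r) - 1) * d3)
      - (1 - s) * (1 - 2 * r) * d3 / (2 - r) * ((2 - r) * p2)
      = (1 - s) * (1 - r) * d3 * p2 * gam := by
    simp only [gam]
    field_simp
    ring
  rw [ea, eb, ec]
  have hA : 0 < (1 - r) * p2 + beta * d3 := by positivity
  have hC : 0 < (1 - s) * (1 - r) * d3 * p2 := by positivity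
  have hB : 0 < (1 - s) * (1 - r) * d3 * p2 * gam := by positivity
  have hstar : (1 - r) * p2star = 1 / gam - beta * d3 := by
    simp only [p2star]; field_simp
  have hg : 1 / gam * gam = 1 := by field_simp
  clear_value p2star gam beta
  constructor
  · intro hp z hz
    refine cubic_stable _ _ _ hA hB hC ?_ z hz
    have k1 : 1 / gam < (1 - r) * p2 + beta * d3 := by
      have := mul_lt_mul_of_pos_left hp hr
      linarith
    have k2 := mul_lt_mul_of_pos_right k1 hB
    linear_combination k2 - (1 - s) * (1 - r) * d3 * p2 * hg
  · intro hp
    refine cubic_unstable _ _ _ hA hB hC ?_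
    have k1 : (1 - r) * p2 + beta * d3 < 1 / gam := by
      have := mul_lt_mul_of_pos_left hp hr
      linarith
    have k2 := mul_lt_mul_of_pos_right k1 hB
    linear_combination k2 + (1 - s) * (1 - r) * d3 * p2 * hg
end

section
/- For all a1 ∈ (1/2, 1) and a2 ∈ (0, a1), the inequalities γ(a1,a2)·(1 − a2/a1) > 1/2 and β(a1,a2) > 1 − a2/a1 hold; consequently γ(a1,a2)·β(a1,a2) > 1/2. -/
/-- **Lower bounds for the auxiliary functions `β` and `γ`**: for all
`a1 ∈ (1/2,1)` and `a2 ∈ (0,a1)` one has `γ·(1 − a2/a1) > 1/2` and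
`β > 1 − a2/a1`; consequently `γ·β > 1/2`. -/
theorem stmt_15 :
    ∀ a1 ∈ Set.Ioo (1 / 2 : ℝ) 1, ∀ a2 ∈ Set.Ioo (0 : ℝ) a1,
    ((1 / (2 * a1)) / (1 - 1 / (2 * a1))
        + (a2 / a1) / ((2 - a2 / a1) * (1 - a2 / a1))) * (1 - a2 / a1)
      > 1 / 2 ∧
    1 - (a2 / a1) * (1 - 1 / (2 * a1)) / (2 - a2 / a1) > 1 - a2 / a1 ∧
    ((1 / (2 * a1)) / (1 - 1 / (2 * a1))
        + (a2 / a1) / ((2 - a2 / a1) * (1 - a2 / a1)))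
      * (1 - (a2 / a1) * (1 - 1 / (2 * a1)) / (2 - a2 / a1)) > 1 / 2 := by
  rintro a1 ⟨h1, h2⟩ a2 ⟨h3, h4⟩
  have ha : 0 < a1 := by linarith
  have hp1 : 1 / 2 < 1 / (2 * a1) := by
    rw [div_lt_div_iff₀ (by norm_num) (by linarith)]; linarith
  have hp2 : 1 / (2 * a1) < 1 := by
    rw [div_lt_one (by linarith)]; linarith
  have hq1 : 0 < a2 / a1 := div_pos h3 ha
  have hq2 : a2 / a1 < 1 := by rw [div_lt_one ha]; exact h4
  generalize 1 / (2 * a1) = p at *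
  generalize a2 / a1 = q at *
  have hr : 1 < p / (1 - p) := by
    rw [lt_div_iff₀ (by linarith)]; linarith
  have hq : 0 < q / ((2 - q) * (1 - q)) :=
    div_pos hq1 (mul_pos (by linarith) (by linarith))
  have A : (p / (1 - p) + q / ((2 - q) * (1 - q))) * (1 - q) > 1 / 2 := by
    have e : q / ((2 - q) * (1 - q)) * (1 - q) = q / (2 - q) := by
      have : 1 - q ≠ 0 := by linarith
      have : 2 - q ≠ 0 := by linarith
      field_simp
    have k : q / (2 - q) > q - 1 / 2 := by
      rw [gt_iff_lt, lt_div_iff₀ (by linarith)]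
      nlinarith [sq_nonneg (q - 3 / 4)]
    rw [add_mul, e]
    nlinarith [mul_pos (sub_pos.2 hr) (sub_pos.2 hq2)]
  have B : 1 - q * (1 - p) / (2 - q) > 1 - q := by
    have : q * (1 - p) / (2 - q) < q := by
      rw [div_lt_iff₀ (by linarith)]
      exact mul_lt_mul_of_pos_left (by linarith) hq1
    linarith
  exact ⟨A, B, A.trans (mul_lt_mul_of_pos_left B (by linarith))⟩
end

section
/- Let a1 ∈ (1/2, 1), a2 ∈ (0, a1), d3 > 0 and p2 > 0, and suppose p2 ≤ (1/(1 − a2/a1))·(1/γ(a1,a2) − β(a1,a2)·d3) (the condition under which the positive steady state E2 exists and is unstable). Then p2 < 2 and d3 < 2; in particular the parameter set A = {(a1,a2,d3,p2) ∈ (0,1)² × ℝ₊² : a1 > 1/2, a1 > a2, p2 ≤ (1/(1 − a2/a1))·(1/γ(a1,a2) − β(a1,a2)·d3)} is a bounded subset of the parameter space. -/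
theorem aux_xy (x y d p : ℝ) (hx0 : 0 < x) (hx1 : x < 1) (hy0 : 1 / 2 < y) (hy1 : y < 1)
    (hd : 0 < d) (hp : 0 < p)
    (h : p ≤ 1 / (1 - x) * (1 / (y / (1 - y) + x / ((2 - x) * (1 - x)))
      - (1 - x * (1 - y) / (2 - x)) * d)) : p < 2 ∧ d < 2 := by
  have h1 : 0 < 1 - x := by linarith
  have h2 : 0 < 2 - x := by linarith
  have h3 : 1 < y / (1 - y) := by
    rw [lt_div_iff₀ (by linarith)]; linarith
  have h4 : 0 < x / ((2 - x) * (1 - x)) := by positivity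
  have hb : 1 / 2 < 1 - x * (1 - y) / (2 - x) := by
    have : x * (1 - y) / (2 - x) < 1 / 2 := by
      rw [div_lt_iff₀ h2]; nlinarith
    linarith
  have h5 : 1 / 2 < (1 - x) * (1 + x / ((2 - x) * (1 - x))) := by
    have : (1 - x) * (1 + x / ((2 - x) * (1 - x))) = (x ^ 2 - 2 * x + 2) / (2 - x) := by
      field_simp
      ring
    rw [this, lt_div_iff₀ h2]
    nlinarith [sq_nonneg (x - 3 / 4)]
  generalize x / ((2 - x) * (1 - x)) = u at *
  generalize y / (1 - y) = v at *
  generalize 1 - x * (1 - y) / (2 - x) = b at *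
  have hg : 0 < v + u := by linarith
  have hbd : 1 / 2 * d < b * d := mul_lt_mul_of_pos_right hb hd
  have h6 : p * (1 - x) ≤ 1 / (v + u) - b * d := by
    rwa [one_div_mul_eq_div, le_div_iff₀ h1] at h
  have h7 : 1 / (v + u) < 1 := by
    rw [div_lt_one hg]; linarith
  have h8 : 0 < p * (1 - x) := by positivity
  refine ⟨?_, by linarith⟩
  have h9 : p * (1 - x) < 1 / (v + u) := by linarith
  rw [lt_div_iff₀ hg] at h9
  have h10 : 1 / 2 < (1 - x) * (v + u) := by nlinarith
  nlinarith

theorem aux_main : ∀ a1 ∈ Set.Ioo (1 / 2 : ℝ) 1, ∀ a2 ∈ Set.Ioo (0 : ℝ) a1,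
      ∀ d3 > (0 : ℝ), ∀ p2 > (0 : ℝ),
      p2 ≤ 1 / (1 - a2 / a1)
          * (1 / ((1 / (2 * a1)) / (1 - 1 / (2 * a1))
              + (a2 / a1) / ((2 - a2 / a1) * (1 - a2 / a1)))
            - (1 - (a2 / a1) * (1 - 1 / (2 * a1)) / (2 - a2 / a1)) * d3) →
      p2 < 2 ∧ d3 < 2 := by
  rintro a1 ⟨ha, ha'⟩ a2 ⟨hb, hb'⟩ d3 hd p2 hp h
  have h0 : 0 < a1 := by linarith
  refine aux_xy (a2 / a1) (1 / (2 * a1)) d3 p2 (by positivity) ?_ ?_ ?_ hd hp h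
  · rw [div_lt_one h0]; exact hb'
  · rw [lt_div_iff₀ (by linarith)]; linarith
  · rw [div_lt_one (by linarith)]; linarith

/-- **Boundedness of the instability region**: if `a1 ∈ (1/2,1)`,
`a2 ∈ (0,a1)`, `d3, p2 > 0` and
`p2 ≤ (1/(1 − a2/a1))·(1/γ(a1,a2) − β(a1,a2)·d3)` (the condition for the
positive steady state `E2` to exist and be unstable), then `p2 < 2` and
`d3 < 2`; in particular the corresponding parameter set `A` is a bounded
subset of the parameter space. -/
theorem stmt_16 :
    (∀ a1 ∈ Set.Ioo (1 / 2 : ℝ) 1, ∀ a2 ∈ Set.Ioo (0 : ℝ) a1,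
      ∀ d3 > (0 : ℝ), ∀ p2 > (0 : ℝ),
      p2 ≤ 1 / (1 - a2 / a1)
          * (1 / ((1 / (2 * a1)) / (1 - 1 / (2 * a1))
              + (a2 / a1) / ((2 - a2 / a1) * (1 - a2 / a1)))
            - (1 - (a2 / a1) * (1 - 1 / (2 * a1)) / (2 - a2 / a1)) * d3) →
      p2 < 2 ∧ d3 < 2) ∧
    Bornology.IsBounded
      {q : ℝ × ℝ × ℝ × ℝ |
        q.1 ∈ Set.Ioo (0 : ℝ) 1 ∧ q.2.1 ∈ Set.Ioo (0 : ℝ) 1 ∧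
        0 < q.2.2.1 ∧ 0 < q.2.2.2 ∧
        1 / 2 < q.1 ∧ q.2.1 < q.1 ∧
        q.2.2.2 ≤ 1 / (1 - q.2.1 / q.1)
          * (1 / ((1 / (2 * q.1)) / (1 - 1 / (2 * q.1))
              + (q.2.1 / q.1) / ((2 - q.2.1 / q.1) * (1 - q.2.1 / q.1)))
            - (1 - (q.2.1 / q.1) * (1 - 1 / (2 * q.1)) / (2 - q.2.1 / q.1))
              * q.2.2.1)} := by
  refine ⟨aux_main, ?_⟩
  refine (Metric.isBounded_Icc ((0, 0, 0, 0) : ℝ × ℝ × ℝ × ℝ) (1, 1, 2, 2)).subset ?_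
  rintro ⟨a1, a2, d3, p2⟩ ⟨h1, h2, h3, h4, h5, h6, h7⟩
  dsimp only at *
  obtain ⟨hp, hd⟩ := aux_main a1 ⟨h5, h1.2⟩ a2 ⟨h2.1, h6⟩ d3 h3 p2 h4 h7
  exact ⟨⟨h1.1.le, h2.1.le, h3.le, h4.le⟩, ⟨h1.2.le, h2.2.le, hd.le, hp.le⟩⟩
end
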